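/- arXiv:1706.07329 — 3 statements merged into one kernel-verified Lean document; each statement's English description precedes it below -/
import Mathlib

section
/- Let A = (A^i)_{i<d} be an MPS tensor with bond dimension D ≥ 1 and physical dimension d ≥ 1. Then there exist r ∈ ℕ, positive integers D_1,…,D_r, complex numbers μ_1,…,μ_r, and MPS tensors A_1,…,A_r with physical dimension d and bond dimensions D_1,…,D_r, each of which is either normal or periodic, such that for every n ≥ 1 and every index string (i_1,…,i_n), Tr(A^{i_1}⋯A^{i_n}) = ∑_{k=1}^r μ_k^n · Tr(A_k^{i_1}⋯A_k^{i_n}); that is, V_n(A) = ∑_k μ_k^n V_n(A_k) for all n. -/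
open Matrix
open scoped ComplexOrder

noncomputable section

/-- The ordered product `A^{i_1} ⋯ A^{i_n}` of the matrices of an MPS tensor along
an index string `i`. -/
def mpsProd {D d : ℕ} (A : Fin d → Matrix (Fin D) (Fin D) ℂ) {n : ℕ}
    (i : Fin n → Fin d) : Matrix (Fin D) (Fin D) ℂ :=
  (List.ofFn fun k => A (i k)).prod

/-- The transfer map `T_A : ρ ↦ ∑ i, A i * ρ * (A i)ᴴ` of an MPS tensor. -/
def transferMap {D d : ℕ} (A : Fin d → Matrix (Fin D) (Fin D) ℂ)
    (ρ : Matrix (Fin D) (Fin D) ℂ) : Matrix (Fin D) (Fin D) ℂ :=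
  ∑ i, A i * ρ * (A i)ᴴ

/-- `A` is normal: some iterate of the transfer map sends every nonzero
positive semidefinite matrix to a positive definite matrix. -/
def IsPrimitive {D d : ℕ} (A : Fin d → Matrix (Fin D) (Fin D) ℂ) : Prop :=
  ∃ n : ℕ, 1 ≤ n ∧ ∀ ρ : Matrix (Fin D) (Fin D) ℂ, ρ.PosSemidef → ρ ≠ 0 →
    ((transferMap A)^[n] ρ).PosDef

/-- The transfer map of `A` is reducible: there is a nontrivial Hermitian projector `P`
with `A^i P = P A^i P` for all `i`. -/
def TransferReducible {D d : ℕ} (A : Fin d → Matrix (Fin D) (Fin D) ℂ) : Prop :=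
  ∃ P : Matrix (Fin D) (Fin D) ℂ, P.IsHermitian ∧ P * P = P ∧ P ≠ 0 ∧ P ≠ 1 ∧
    ∀ i, A i * P = P * (A i * P)

/-- `A` is periodic: its transfer map is irreducible but not primitive. -/
def IsPeriodic {D d : ℕ} (A : Fin d → Matrix (Fin D) (Fin D) ℂ) : Prop :=
  ¬ TransferReducible A ∧ ¬ IsPrimitive A

/-- An idempotent matrix factors as `U * V` through its range, with `V * U = 1`. -/
theorem exists_factorization_of_idempotent {D : ℕ} {P : Matrix (Fin D) (Fin D) ℂ}
    (hP : P * P = P) :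
    ∃ (k : ℕ) (U : Matrix (Fin D) (Fin k) ℂ) (V : Matrix (Fin k) (Fin D) ℂ),
      U * V = P ∧ V * U = 1 := by
  set f := P.toLin' with hf
  have hff : f ∘ₗ f = f := by rw [hf, ← Matrix.toLin'_mul, hP]
  let b := Module.finBasis ℂ (LinearMap.range f)
  let e := Pi.basisFun ℂ (Fin D)
  refine ⟨_, LinearMap.toMatrix b e (LinearMap.range f).subtype,
    LinearMap.toMatrix e b f.rangeRestrict, ?_, ?_⟩
  · rw [← LinearMap.toMatrix_comp e b e, LinearMap.subtype_comp_codRestrict]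
    exact LinearMap.toMatrix'_toLin' P
  · rw [← LinearMap.toMatrix_comp b e b, ← LinearMap.toMatrix_id b]
    congr 1
    ext ⟨x, y, rfl⟩ : 2
    exact LinearMap.congr_fun hff y

/-- The product of an MPS tensor along an index string, as a product over a mapped list. -/
theorem mpsProd_eq_prod_map {D d : ℕ} (A : Fin d → Matrix (Fin D) (Fin D) ℂ) {n : ℕ}
    (i : Fin n → Fin d) : mpsProd A i = ((List.ofFn i).map A).prod := by
  rw [mpsProd, List.map_ofFn]
  rfl

/-- An intertwiner of two MPS tensors intertwines their products. -/
theorem mpsProd_mul_of_intertwines {D k d : ℕ} {A : Fin d → Matrix (Fin D) (Fin D) ℂ}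
    {B : Fin d → Matrix (Fin k) (Fin k) ℂ} {U : Matrix (Fin D) (Fin k) ℂ}
    (h : ∀ j, A j * U = U * B j) {n : ℕ} (i : Fin n → Fin d) :
    mpsProd A i * U = U * mpsProd B i := by
  simp only [mpsProd_eq_prod_map]
  induction List.ofFn i with
  | nil => simp
  | cons j l ih =>
    rw [List.map_cons, List.map_cons, List.prod_cons, List.prod_cons, Matrix.mul_assoc, ih,
      ← Matrix.mul_assoc, h, Matrix.mul_assoc]

/-- A reducible MPS tensor has the same traces as the sum of two strictly smaller ones. -/
theorem TransferReducible.exists_trace_eq_add {D d : ℕ}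
    {A : Fin d → Matrix (Fin D) (Fin D) ℂ} (hA : TransferReducible A) :
    ∃ (k l : ℕ) (B : Fin d → Matrix (Fin k) (Fin k) ℂ) (C : Fin d → Matrix (Fin l) (Fin l) ℂ),
      1 ≤ k ∧ k < D ∧ 1 ≤ l ∧ l < D ∧ ∀ (n : ℕ) (i : Fin n → Fin d),
        (mpsProd A i).trace = (mpsProd B i).trace + (mpsProd C i).trace := by
  obtain ⟨P, -, hPP, hP0, hP1, hAP⟩ := hA
  obtain ⟨k, U, V, hUV, hVU⟩ := exists_factorization_of_idempotent hPP
  obtain ⟨l, W, X, hWX, hXW⟩ := exists_factorization_of_idempotent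
    (P := 1 - P) (IsIdempotentElem.one_sub hPP)
  have hsum : U * V + W * X = 1 := by rw [hUV, hWX]; abel
  have hkl : k + l = D := by
    have h := congrArg Matrix.trace hsum
    rw [Matrix.trace_add, Matrix.trace_mul_comm U, Matrix.trace_mul_comm W, hVU, hXW] at h
    simp only [Matrix.trace_one, Fintype.card_fin] at h
    exact_mod_cast h
  have hk : k ≠ 0 := by
    rintro rfl
    exact hP0 (by rw [← hUV]; ext; simp [Matrix.mul_apply])
  have hl : l ≠ 0 := by
    rintro rfl
    exact hP1 (sub_eq_zero.mp (by rw [← hWX]; ext; simp [Matrix.mul_apply])).symm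
  refine ⟨k, l, fun j => V * A j * U, fun j => X * A j * W, by omega, by omega, by omega,
    by omega, fun n i => ?_⟩
  have hU : ∀ j, A j * U = U * (V * A j * U) := fun j => by
    have hPU : P * U = U := by rw [← hUV, Matrix.mul_assoc, hVU, Matrix.mul_one]
    calc A j * U = A j * P * U := by rw [Matrix.mul_assoc, hPU]
      _ = P * (A j * P) * U := by rw [← hAP]
      _ = P * (A j * (P * U)) := by simp only [Matrix.mul_assoc]
      _ = U * (V * A j * U) := by rw [hPU, ← hUV]; simp only [Matrix.mul_assoc]
  have hX : ∀ j, (X * A j * W) * X = X * A j := fun j => by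
    have hXP : X * P = 0 := by
      have h : X * (1 - P) = X := by rw [← hWX, ← Matrix.mul_assoc, hXW, Matrix.one_mul]
      rw [Matrix.mul_sub, Matrix.mul_one] at h
      simpa using h
    rw [Matrix.mul_assoc, hWX, Matrix.mul_sub, Matrix.mul_one, Matrix.mul_assoc, hAP,
      ← Matrix.mul_assoc X P, hXP, Matrix.zero_mul, sub_zero]
  have hX' : mpsProd (fun j => X * A j * W) i * X = X * mpsProd A i :=
    mpsProd_mul_of_intertwines hX i
  calc (mpsProd A i).trace = (mpsProd A i * (U * V + W * X)).trace := by
        rw [hsum, Matrix.mul_one]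
    _ = (V * (mpsProd A i * U)).trace + (X * mpsProd A i * W).trace := by
        rw [Matrix.mul_add, Matrix.trace_add, ← Matrix.mul_assoc, ← Matrix.mul_assoc,
          Matrix.trace_mul_comm _ V, Matrix.trace_mul_comm _ X, Matrix.mul_assoc X]
    _ = _ := by
        rw [mpsProd_mul_of_intertwines hU, ← hX', ← Matrix.mul_assoc, hVU, Matrix.one_mul,
          Matrix.mul_assoc _ X, hXW, Matrix.mul_one]

/-- The traces of an MPS tensor are sums of traces of finitely many irreducible ones. -/
theorem exists_list_irreducible_trace_eq_sum {d : ℕ} (D : ℕ) (hD : 1 ≤ D)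
    (A : Fin d → Matrix (Fin D) (Fin D) ℂ) :
    ∃ L : List (Σ k : ℕ, Fin d → Matrix (Fin k) (Fin k) ℂ),
      (∀ B ∈ L, 1 ≤ B.1 ∧ ¬ TransferReducible B.2) ∧
      ∀ (n : ℕ) (i : Fin n → Fin d),
        (mpsProd A i).trace = (L.map fun B => (mpsProd B.2 i).trace).sum := by
  induction D using Nat.strong_induction_on with
  | _ D ih =>
    by_cases hA : TransferReducible A
    · obtain ⟨k, l, B, C, hk, hkD, hl, hlD, h⟩ := hA.exists_trace_eq_add
      obtain ⟨L, hL, hLB⟩ := ih k hkD hk B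
      obtain ⟨M, hM, hMC⟩ := ih l hlD hl C
      refine ⟨L ++ M, fun N hN => (List.mem_append.mp hN).elim (hL N) (hM N), fun n i => ?_⟩
      rw [h, hLB, hMC, List.map_append, List.sum_append]
    · exact ⟨[⟨D, A⟩], by simp [hD, hA], by simp⟩

/-- **Decomposition of an MPS into normal and periodic MPSs.**
Any MPS can be written as a linear combination `V_n(A) = ∑_k μ_k^n V_n(A_k)` where each
`A_k` is either normal or periodic. -/
theorem mps_decomposition_normal_periodic {D d : ℕ} (hD : 1 ≤ D) (hd : 1 ≤ d)
    (A : Fin d → Matrix (Fin D) (Fin D) ℂ) :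
    ∃ (r : ℕ) (Dk : Fin r → ℕ) (μ : Fin r → ℂ)
      (Ak : ∀ k : Fin r, Fin d → Matrix (Fin (Dk k)) (Fin (Dk k)) ℂ),
      (∀ k, 1 ≤ Dk k) ∧
      (∀ k, IsPrimitive (Ak k) ∨ IsPeriodic (Ak k)) ∧
      ∀ n : ℕ, 1 ≤ n → ∀ i : Fin n → Fin d,
        (mpsProd A i).trace = ∑ k, μ k ^ n * (mpsProd (Ak k) i).trace := by
  obtain ⟨L, hL, h⟩ := exists_list_irreducible_trace_eq_sum D hD A
  refine ⟨L.length, fun k => (L.get k).1, fun _ => 1, fun k => (L.get k).2,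
    fun k => (hL _ (L.get_mem k)).1, fun k => ?_, fun n _ i => ?_⟩
  · exact or_iff_not_imp_left.mpr fun hk => ⟨(hL _ (L.get_mem k)).2, hk⟩
  · simp only [one_pow, one_mul, h]
    exact (Fin.sum_univ_fun_getElem L fun B => (mpsProd B.2 i).trace).symm
end
end

section
/- Let A = (A^i)_{i<d} be an MPS tensor with bond dimension D. (i) If A is injective, then A is normal, i.e., its transfer map T_A is primitive. (ii) Conversely, if A is normal, then there exists L₀ ∈ ℕ such that for every L ≥ L₀ the L-fold blocking of A is injective: the only D×D complex matrix ρ satisfying Tr(A^{i_1}⋯A^{i_L} ρ) = 0 for all index strings (i_1,…,i_L) is ρ = 0. -/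
open Matrix
open scoped ComplexOrder

noncomputable section

/-- `A` is injective: the only `ρ` with `Tr(A^i ρ) = 0` for all `i` is `ρ = 0`. -/
def InjectiveTensor {D d : ℕ} (A : Fin d → Matrix (Fin D) (Fin D) ℂ) : Prop :=
  ∀ ρ : Matrix (Fin D) (Fin D) ℂ, (∀ i, (A i * ρ).trace = 0) → ρ = 0

/-- A submodule of `Module.End K V` acts transitively if it carries every nonzero vector
to every vector. -/
def ActsTransitively {K V : Type*} [Field K] [AddCommGroup V] [Module K V]
    (S : Submodule K (Module.End K V)) : Prop :=
  ∀ x : V, x ≠ 0 → ∀ z : V, ∃ f ∈ S, f x = z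

section Transitive

variable {K V : Type*} [Field K] [AddCommGroup V] [Module K V]

theorem ActsTransitively.pow_succ {S : Submodule K (Module.End K V)} {N : ℕ} (hN : 1 ≤ N)
    (h : ActsTransitively (S ^ N)) : ActsTransitively (S ^ (N + 1)) := by
  intro x hx z
  obtain ⟨s, hs, hsx⟩ : ∃ s ∈ S, s x ≠ 0 := by
    by_contra! hS
    obtain ⟨f, hf, hfx⟩ := h x hx x
    obtain ⟨M, rfl⟩ := Nat.exists_eq_add_of_le' hN
    rw [_root_.pow_succ] at hf
    have hle : S ^ M * S ≤ LinearMap.ker (LinearMap.applyₗ x : Module.End K V →ₗ[K] V) :=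
      Submodule.mul_le.mpr fun a _ b hb => by simp [hS b hb]
    exact hx (hfx ▸ hle hf)
  obtain ⟨f, hf, hfz⟩ := h _ hsx z
  exact ⟨f * s, _root_.pow_succ S N ▸ Submodule.mul_mem_mul hf hs, hfz⟩

theorem ActsTransitively.pow_of_le {S : Submodule K (Module.End K V)} {N m : ℕ} (hN : 1 ≤ N)
    (h : ActsTransitively (S ^ N)) (hm : N ≤ m) : ActsTransitively (S ^ m) := by
  induction m, hm using Nat.le_induction with
  | base => exact h
  | succ m hm ih => exact ih.pow_succ (hN.trans hm)

variable [FiniteDimensional K V]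

theorem ActsTransitively.exists_dual_comp {S : Submodule K (Module.End K V)}
    (h : ActsTransitively S) {φ : Module.Dual K V} (hφ : φ ≠ 0) (ψ : Module.Dual K V) :
    ∃ q ∈ S, φ ∘ₗ q = ψ := by
  suffices hW : S.map (LinearMap.compRight K φ : Module.End K V →ₗ[K] Module.Dual K V) = ⊤ by
    have := hW ▸ Submodule.mem_top (x := ψ)
    simpa using this
  by_contra hW
  obtain ⟨F, hF, hWF⟩ := Submodule.exists_le_ker_of_lt_top _ (lt_top_iff_ne_top.mpr hW)
  obtain ⟨y, rfl⟩ := (Module.evalEquiv K V).surjective F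
  have hy : y ≠ 0 := by rintro rfl; simp at hF
  refine hφ (LinearMap.ext fun z => ?_)
  obtain ⟨f, hf, rfl⟩ := h y hy z
  simpa using hWF (Submodule.mem_map_of_mem hf)

/-- An endomorphism `b` of minimal rank among the nonzero elements of the powers of `S` has
rank one: two elements of `b * S ^ N * b` act on the range of `b` as a pencil, which is singular
for some parameter. -/
theorem ActsTransitively.exists_rank_one_mem_pow [IsAlgClosed K] [Nontrivial V]
    {S : Submodule K (Module.End K V)} {N : ℕ} (h : ActsTransitively (S ^ N)) :
    ∃ (k : ℕ) (φ : Module.Dual K V) (u : V), φ ≠ 0 ∧ u ≠ 0 ∧ φ.smulRight u ∈ S ^ k := by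
  classical
  have hne : ∃ r : ℕ, ∃ k, ∃ b ∈ S ^ k, b ≠ 0 ∧ Module.finrank K (LinearMap.range b) = r :=
    ⟨_, 0, 1, by simp [Submodule.one_le.mp le_rfl], one_ne_zero, rfl⟩
  obtain ⟨k, b, hb, hb0, hr⟩ := Nat.find_spec hne
  have hmin : ∀ j, ∀ a ∈ S ^ j,
      Module.finrank K (LinearMap.range a) < Module.finrank K (LinearMap.range b) → a = 0 := by
    intro j a ha hlt
    by_contra ha0
    exact Nat.find_min hne (hr ▸ hlt) ⟨j, a, ha, ha0, rfl⟩
  -- `b * c` acting on the range of `b`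
  let f : Module.End K V → Module.End K (LinearMap.range b) := fun c =>
    b.rangeRestrict ∘ₗ c ∘ₗ (LinearMap.range b).subtype
  have hf : ∀ c ∈ S ^ N, ¬ Function.Injective (f c) → b * c * b = 0 := by
    intro c hc hinj
    refine hmin (k + N + k) _ ?_ ?_
    · rw [pow_add, pow_add]
      exact Submodule.mul_mem_mul (Submodule.mul_mem_mul hb hc) hb
    · have hrange : LinearMap.range (b * c * b) =
          (LinearMap.range (f c)).map (LinearMap.range b).subtype := by
        ext z
        constructor
        · rintro ⟨y, rfl⟩
          exact ⟨_, ⟨⟨b y, y, rfl⟩, rfl⟩, rfl⟩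
        · rintro ⟨_, ⟨⟨_, y, rfl⟩, rfl⟩, rfl⟩
          exact ⟨y, rfl⟩
      rw [hrange, Submodule.finrank_map_subtype_eq]
      refine Submodule.finrank_lt ?_
      rw [ne_eq, LinearMap.range_eq_top, ← LinearMap.injective_iff_surjective]
      exact hinj
  obtain ⟨x, hx⟩ : ∃ x, b x ≠ 0 := by
    by_contra! hx
    exact hb0 (LinearMap.ext hx)
  obtain ⟨c₂, hc₂, hc₂x⟩ := h _ hx x
  have hinj : Function.Injective (f c₂) := by
    by_contra hinj
    have := LinearMap.congr_fun (hf c₂ hc₂ hinj) x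
    simp [hc₂x, hx] at this
  have hspan : ∀ z, ∃ t : K, b z = t • b x := by
    intro z
    obtain ⟨c₁, hc₁, hc₁x⟩ := h _ hx z
    have : Nontrivial (LinearMap.range b) := ⟨⟨b x, x, rfl⟩, 0, by simpa [Subtype.ext_iff] using hx⟩
    let e := LinearEquiv.ofInjectiveEndo (f c₂) hinj
    obtain ⟨t, ht⟩ := Module.End.exists_eigenvalue (e.symm.toLinearMap ∘ₗ f c₁)
    obtain ⟨w, hw⟩ := ht.exists_hasEigenvector
    refine ⟨t, ?_⟩
    have hw' : f c₁ w = t • f c₂ w := by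
      have := congrArg e hw.apply_eq_smul
      simpa [e] using this
    have hsub : f (c₁ - t • c₂) w = 0 := by
      have : f (c₁ - t • c₂) w = f c₁ w - t • f c₂ w := by
        ext; simp [f]
      rw [this, hw', sub_self]
    have h0 := hf (c₁ - t • c₂) (Submodule.sub_mem _ hc₁ (Submodule.smul_mem _ _ hc₂))
      fun hi => hw.2 (hi (by rw [hsub, map_zero]))
    have := LinearMap.congr_fun h0 x
    simpa [hc₁x, hc₂x, sub_eq_zero] using this
  obtain ⟨g, hg⟩ := Module.Projective.exists_dual_eq_one K hx
  have hb_eq : (g ∘ₗ b).smulRight (b x) = b := by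
    ext z
    obtain ⟨t, ht⟩ := hspan z
    simp [ht, hg]
  exact ⟨k, g ∘ₗ b, b x, fun h0 => by simpa [hg] using LinearMap.congr_fun h0 x, hx,
    hb_eq.symm ▸ hb⟩

/-- If some positive power of a space `S` of endomorphisms acts transitively, then all
sufficiently high powers of `S` are the full endomorphism algebra. -/
theorem ActsTransitively.exists_forall_pow_eq_top [IsAlgClosed K]
    {S : Submodule K (Module.End K V)} {N : ℕ} (hN : 1 ≤ N) (h : ActsTransitively (S ^ N)) :
    ∃ L₀ : ℕ, ∀ L, L₀ ≤ L → S ^ L = ⊤ := by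
  rcases subsingleton_or_nontrivial V with hV | hV
  · exact ⟨0, fun L _ => Subsingleton.elim _ _⟩
  obtain ⟨k, φ, u, hφ, hu, hp⟩ := h.exists_rank_one_mem_pow
  refine ⟨N + k + N, fun L hL => ?_⟩
  obtain ⟨m, hm, rfl⟩ : ∃ m, N ≤ m ∧ L = m + k + N := ⟨L - k - N, by omega, by omega⟩
  have hrank : ∀ (ψ : Module.Dual K V) (v : V), ψ.smulRight v ∈ S ^ (m + k + N) := by
    intro ψ v
    obtain ⟨a, ha, rfl⟩ := h.pow_of_le hN hm u hu v
    obtain ⟨q, hq, rfl⟩ := h.exists_dual_comp hφ ψ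
    have : (φ ∘ₗ q).smulRight (a u) = a * φ.smulRight u * q := by
      ext z; simp
    rw [this, pow_add, pow_add]
    exact Submodule.mul_mem_mul (Submodule.mul_mem_mul ha hp) hq
  refine eq_top_iff.mpr fun f _ => ?_
  let B := Module.finBasis K V
  have : f = ∑ i, (B.coord i).smulRight (f (B i)) := by
    refine B.ext fun j => ?_
    simp [Finsupp.single_apply]
  rw [this]
  exact Submodule.sum_mem _ fun i _ => hrank _ _

end Transitive

section Transfer

open scoped Pointwise

variable {D d : ℕ}

theorem vecMul_iterate_transferMap_eq_zero (A : Fin d → Matrix (Fin D) (Fin D) ℂ)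
    (ρ : Matrix (Fin D) (Fin D) ℂ) (n : ℕ) (y : Fin D → ℂ)
    (h : ∀ M ∈ Submodule.span ℂ (Set.range A) ^ n, y ᵥ* (M * ρ) = 0) :
    y ᵥ* (transferMap A)^[n] ρ = 0 := by
  induction n generalizing y with
  | zero => simpa using h 1 (by simp [Submodule.one_le.mp le_rfl])
  | succ n ih =>
    rw [Function.iterate_succ_apply', transferMap, Matrix.vecMul_sum]
    refine Finset.sum_eq_zero fun i _ => ?_
    rw [← Matrix.vecMul_vecMul, ← Matrix.vecMul_vecMul, ih, Matrix.zero_vecMul]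
    intro M hM
    rw [Matrix.vecMul_vecMul, ← mul_assoc]
    refine h _ ?_
    rw [pow_succ']
    exact Submodule.mul_mem_mul (Submodule.subset_span ⟨i, rfl⟩) hM

theorem actsTransitively_of_iterate_transferMap_posDef {A : Fin d → Matrix (Fin D) (Fin D) ℂ}
    {n : ℕ} (h : ∀ ρ : Matrix (Fin D) (Fin D) ℂ, ρ.PosSemidef → ρ ≠ 0 →
      ((transferMap A)^[n] ρ).PosDef) :
    ActsTransitively (((Submodule.span ℂ (Set.range A)).map
      (Matrix.toLinAlgEquiv' : Matrix (Fin D) (Fin D) ℂ ≃ₐ[ℂ] _).toLinearMap) ^ n) := by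
  have hmap := Submodule.map_pow (Submodule.span ℂ (Set.range A))
    (Matrix.toLinAlgEquiv' : Matrix (Fin D) (Fin D) ℂ ≃ₐ[ℂ] _).toAlgHom n
  intro x hx z
  let W := (Submodule.span ℂ (Set.range A) ^ n).map
    (LinearMap.applyₗ x ∘ₗ (Matrix.toLin' : Matrix (Fin D) (Fin D) ℂ ≃ₗ[ℂ] _).toLinearMap)
  suffices hW : W = ⊤ by
    obtain ⟨M, hM, rfl⟩ := hW ▸ Submodule.mem_top (x := z)
    exact ⟨Matrix.toLinAlgEquiv' M, hmap ▸ Submodule.mem_map_of_mem hM, rfl⟩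
  by_contra hW
  obtain ⟨F, hF, hWF⟩ := Submodule.exists_le_ker_of_lt_top _ (lt_top_iff_ne_top.mpr hW)
  obtain ⟨y, rfl⟩ := (dotProductEquiv ℂ (Fin D)).surjective F
  have hy : y ≠ 0 := by rintro rfl; simp at hF
  have hpd := h (vecMulVec x (star x)) (posSemidef_vecMulVec_self_star x) (by simp [hx])
  have h0 := vecMul_iterate_transferMap_eq_zero A (vecMulVec x (star x)) n y fun M hM => by
    have : y ⬝ᵥ M *ᵥ x = 0 := by simpa using hWF (Submodule.mem_map_of_mem hM)
    rw [Matrix.mul_vecMulVec, Matrix.vecMul_vecMulVec, this, zero_smul]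
  exact hy (Matrix.vecMul_injective_of_isUnit hpd.isUnit (by simpa using h0))

theorem InjectiveTensor.isPrimitive {A : Fin d → Matrix (Fin D) (Fin D) ℂ}
    (hA : InjectiveTensor A) : IsPrimitive A := by
  refine ⟨1, le_rfl, fun ρ hρ hρ0 => ?_⟩
  have hT : (transferMap A ρ).PosSemidef :=
    Matrix.posSemidef_sum _ fun i _ => hρ.mul_mul_conjTranspose_same (A i)
  rw [Function.iterate_one]
  refine .of_dotProduct_mulVec_pos hT.isHermitian fun x hx =>
    lt_of_le_of_ne (hT.dotProduct_mulVec_nonneg x) fun h0 => hρ0 ?_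
  have hsum : star x ⬝ᵥ transferMap A ρ *ᵥ x =
      ∑ i, star ((A i)ᴴ *ᵥ x) ⬝ᵥ ρ *ᵥ ((A i)ᴴ *ᵥ x) := by
    simp [transferMap, Matrix.sum_mulVec, dotProduct_sum, Matrix.star_mulVec,
      Matrix.dotProduct_mulVec, Matrix.vecMul_vecMul, mul_assoc]
  have hterm : ∀ i, ρ *ᵥ ((A i)ᴴ *ᵥ x) = 0 := fun i =>
    (hρ.dotProduct_mulVec_zero_iff _).mp <|
      (Finset.sum_eq_zero_iff_of_nonneg fun i _ => hρ.dotProduct_mulVec_nonneg _).mp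
        (hsum.symm.trans h0.symm) i (Finset.mem_univ i)
  refine Matrix.ext_of_mulVec_single fun j => ?_
  set z : Fin D → ℂ := Pi.single j 1
  have hz : ρ * vecMulVec z (star x) = 0 := hA _ fun i => by
    have hconj := congrArg star (hterm i)
    rw [Matrix.star_mulVec, Matrix.star_mulVec, Matrix.conjTranspose_conjTranspose,
      hρ.isHermitian.eq, star_zero] at hconj
    rw [Matrix.mul_vecMulVec, Matrix.mul_vecMulVec, Matrix.trace_vecMulVec, dotProduct_comm,
      Matrix.dotProduct_mulVec, Matrix.dotProduct_mulVec, hconj, zero_dotProduct]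
  rw [Matrix.mul_vecMulVec, Matrix.vecMulVec_eq_zero] at hz
  rw [Matrix.zero_mulVec]
  exact hz.resolve_right (star_ne_zero.mpr hx)

theorem exists_mpsProd_eq_of_mem_range_pow (A : Fin d → Matrix (Fin D) (Fin D) ℂ) {L : ℕ}
    {M : Matrix (Fin D) (Fin D) ℂ} (hM : M ∈ Set.range A ^ L) :
    ∃ i : Fin L → Fin d, mpsProd A i = M := by
  obtain ⟨f, rfl⟩ := Set.mem_pow.mp hM
  choose i hi using fun k => (f k).2
  exact ⟨i, by simp [mpsProd, hi]⟩

end Transfer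

/-- **Injective ↔ normal up to blocking.**
(i) An injective MPS tensor is normal (its transfer map is primitive).
(ii) A normal MPS tensor becomes injective after blocking any `L ≥ L₀` sites, i.e. the
only `ρ` with `Tr(A^{i_1}⋯A^{i_L} ρ) = 0` for all index strings is `ρ = 0`. -/
theorem injective_iff_normal_after_blocking {D d : ℕ}
    (A : Fin d → Matrix (Fin D) (Fin D) ℂ) :
    (InjectiveTensor A → IsPrimitive A) ∧
    (IsPrimitive A → ∃ L₀ : ℕ, ∀ L : ℕ, L₀ ≤ L →
      ∀ ρ : Matrix (Fin D) (Fin D) ℂ,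
        (∀ i : Fin L → Fin d, (mpsProd A i * ρ).trace = 0) → ρ = 0) := by
  refine ⟨InjectiveTensor.isPrimitive, ?_⟩
  rintro ⟨n, hn, hpos⟩
  obtain ⟨L₀, hL₀⟩ :=
    (actsTransitively_of_iterate_transferMap_posDef hpos).exists_forall_pow_eq_top hn
  refine ⟨L₀, fun L hL ρ hρ => Matrix.ext_iff_trace_mul_left.mpr fun M => ?_⟩
  have hM : M ∈ Submodule.span ℂ (Set.range A) ^ L := by
    have htop := hL₀ L hL
    have hmap := Submodule.map_pow (Submodule.span ℂ (Set.range A))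
      (Matrix.toLinAlgEquiv' : Matrix (Fin D) (Fin D) ℂ ≃ₐ[ℂ] _).toAlgHom L
    obtain ⟨M', hM', h⟩ := (hmap.trans htop).symm ▸
      Submodule.mem_top (x := Matrix.toLinAlgEquiv' M)
    exact Matrix.toLinAlgEquiv'.injective h ▸ hM'
  rw [Submodule.span_pow] at hM
  rw [mul_zero, trace_zero]
  induction hM using Submodule.span_induction with
  | mem M hM =>
    obtain ⟨i, rfl⟩ := exists_mpsProd_eq_of_mem_range_pow A hM
    exact hρ i
  | zero => simp
  | add M M' _ _ h h' => rw [add_mul, trace_add, h, h', add_zero]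
  | smul c M _ h => rw [smul_mul_assoc, trace_smul, h, smul_zero]
end
end

section
/- Let A be a normal MPS tensor and B an MPS tensor with the same physical dimension d, and let (V,W) and (Ṽ,W̃) be two reductions from B to A, both with nilpotency length at most N₀ (i.e., all products of at least N₀ of the matrices N^i = B^i − W A^i V vanish, and likewise for Ñ^i = B^i − W̃ A^i Ṽ). Then there exists a nonzero λ ∈ ℂ such that for every n > 2N₀ and all indices i_1,…,i_n ∈ {0,…,d−1}: V B^{i_1} B^{i_2} ⋯ B^{i_n} = λ Ṽ B^{i_1} B^{i_2} ⋯ B^{i_n} and B^{i_1} B^{i_2} ⋯ B^{i_n} W = λ^{−1} B^{i_1} B^{i_2} ⋯ B^{i_n} W̃. -/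
open Matrix
open scoped ComplexOrder

noncomputable section

open Module in
/-- **Burnside's theorem** on matrix algebras: a subalgebra of `End ℂ M` acting irreducibly on a
nonzero finite-dimensional space is everything. -/
theorem Subalgebra.eq_top_of_invariant_submodules {k M : Type*} [Field k] [IsAlgClosed k]
    [AddCommGroup M] [Module k M] [FiniteDimensional k M] [Nontrivial M]
    (S : Subalgebra k (End k M))
    (h : ∀ U : Submodule k M, (∀ f ∈ S, ∀ v ∈ U, f v ∈ U) → U = ⊥ ∨ U = ⊤) : S = ⊤ := by
  have hsimple : IsSimpleModule S M := by
    refine (isSimpleModule_iff S M).mpr ⟨fun U => ?_⟩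
    rcases h (U.restrictScalars k) fun f hf v hv => U.smul_mem (⟨f, hf⟩ : S) hv with hU | hU
    · exact .inl ((Submodule.restrictScalars_eq_bot_iff k S M).mp hU)
    · exact .inr ((Submodule.restrictScalars_eq_top_iff k S M).mp hU)
  refine eq_top_iff.mpr fun f _ => ?_
  have hbij := IsSimpleModule.algebraMap_end_bijective_of_isAlgClosed (A := S) (V := M) k
  let F : End (End S M) M :=
    { toFun := f
      map_add' := f.map_add
      map_smul' := fun g m => by
        obtain ⟨c, rfl⟩ := hbij.2 g
        exact f.map_smul c m }
  obtain ⟨s, hs⟩ := Module.Finite.fg_top (R := k) (M := M)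
  obtain ⟨r, hr⟩ := jacobson_density F s
  have hfr : f = r.1 := LinearMap.ext_on hs fun m hm => hr m hm
  exact hfr ▸ r.2

/-- The product of the matrices of a tensor along a word. -/
def wordProd {D α R : Type*} [Fintype D] [DecidableEq D] [Semiring R] (A : α → Matrix D D R)
    (w : List α) : Matrix D D R :=
  (w.map A).prod

section WordProd

variable {D α R : Type*} [Fintype D] [DecidableEq D] [Semiring R] (A : α → Matrix D D R)

@[simp]
theorem wordProd_nil : wordProd A [] = 1 := rfl

@[simp]
theorem wordProd_cons (i : α) (w : List α) : wordProd A (i :: w) = A i * wordProd A w := by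
  simp [wordProd]

@[simp]
theorem wordProd_append (u w : List α) :
    wordProd A (u ++ w) = wordProd A u * wordProd A w := by
  simp [wordProd]

theorem wordProd_singleton (i : α) : wordProd A [i] = A i := by simp

end WordProd

theorem mpsProd_eq_wordProd {D d n : ℕ} (A : Fin d → Matrix (Fin D) (Fin D) ℂ)
    (i : Fin n → Fin d) : mpsProd A i = wordProd A (List.ofFn i) := by
  simp [mpsProd, wordProd, List.map_ofFn, Function.comp_def]

theorem mpsProd_get {D d : ℕ} (A : Fin d → Matrix (Fin D) (Fin D) ℂ) (w : List (Fin d)) :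
    mpsProd A w.get = wordProd A w := by
  rw [mpsProd_eq_wordProd, List.ofFn_get]

section Span

variable {D d : ℕ} {A : Fin d → Matrix (Fin D) (Fin D) ℂ}

/-- The span of the products of `A` along the words of length at least `K`. -/
def longWordSpan (A : Fin d → Matrix (Fin D) (Fin D) ℂ) (K : ℕ) :
    Submodule ℂ (Matrix (Fin D) (Fin D) ℂ) :=
  Submodule.span ℂ (wordProd A '' {w | K ≤ w.length})

theorem wordProd_mem_longWordSpan {K : ℕ} {w : List (Fin d)} (hw : K ≤ w.length) :
    wordProd A w ∈ longWordSpan A K :=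
  Submodule.subset_span ⟨w, hw, rfl⟩

theorem longWordSpan_mul_le (K L : ℕ) :
    longWordSpan A K * longWordSpan A L ≤ longWordSpan A (K + L) := by
  rw [longWordSpan, longWordSpan, Submodule.span_mul_span, Submodule.span_le]
  rintro _ ⟨_, ⟨u, hu, rfl⟩, _, ⟨w, hw, rfl⟩, rfl⟩
  dsimp only
  rw [← wordProd_append]
  refine wordProd_mem_longWordSpan ?_
  simp only [Set.mem_ofPred_eq] at hu hw
  simp only [List.length_append]
  omega

/-- A nonzero subspace invariant under all matrices of a normal tensor is the whole space. -/
theorem IsPrimitive.invariant_eq_top (hA : IsPrimitive A) (U : Submodule ℂ (Fin D → ℂ))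
    (hU : ∀ i, ∀ v ∈ U, A i *ᵥ v ∈ U) (hne : U ≠ ⊥) : U = ⊤ := by
  obtain ⟨n, -, hn⟩ := hA
  obtain ⟨v, hvU, hv⟩ := U.ne_bot_iff.mp hne
  have hiter : ∀ k y, (transferMap A)^[k] (vecMulVec v (star v)) *ᵥ y ∈ U := by
    intro k
    induction k with
    | zero =>
      intro y
      simp only [Function.iterate_zero, id_eq, vecMulVec_mulVec, op_smul_eq_smul]
      exact U.smul_mem _ hvU
    | succ k ih =>
      intro y
      rw [Function.iterate_succ_apply', transferMap, sum_mulVec]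
      refine U.sum_mem fun i _ => ?_
      rw [← mulVec_mulVec, ← mulVec_mulVec]
      exact hU i _ (ih _)
  have hpos := hn _ (posSemidef_vecMulVec_self_star v)
    (vecMulVec_ne_zero hv (star_ne_zero.mpr hv))
  refine eq_top_iff.mpr fun x _ => ?_
  obtain ⟨y, rfl⟩ := mulVec_surjective_iff_isUnit.mpr hpos.isUnit x
  exact hiter n y

theorem IsPrimitive.longWordSpan_zero (hA : IsPrimitive A) [NeZero D] :
    longWordSpan A 0 = ⊤ := by
  let S : Subalgebra ℂ (Matrix (Fin D) (Fin D) ℂ) :=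
    (longWordSpan A 0).toSubalgebra (wordProd_mem_longWordSpan (w := []) (Nat.zero_le _))
      fun x y hx hy => longWordSpan_mul_le 0 0 (Submodule.mul_mem_mul hx hy)
  have hS : S.map (toLinAlgEquiv' : _ ≃ₐ[ℂ] _).toAlgHom = ⊤ := by
    refine Subalgebra.eq_top_of_invariant_submodules _ fun U hU => ?_
    by_cases hne : U = ⊥
    · exact .inl hne
    refine .inr (hA.invariant_eq_top U (fun i v hv => ?_) hne)
    refine hU (toLinAlgEquiv' (A i)) ⟨A i, ?_, rfl⟩ v hv
    have := wordProd_mem_longWordSpan (A := A) (K := 0) (w := [i]) (Nat.zero_le _)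
    rwa [wordProd_singleton] at this
  refine eq_top_iff.mpr fun M _ => ?_
  have hM : toLinAlgEquiv' M ∈ S.map (toLinAlgEquiv' : _ ≃ₐ[ℂ] _).toAlgHom := hS ▸ trivial
  obtain ⟨M', hM', h⟩ := hM
  exact toLinAlgEquiv'.injective h ▸ hM'

theorem IsPrimitive.longWordSpan_one (hA : IsPrimitive A) [NeZero D] :
    longWordSpan A 1 = ⊤ := by
  have hA' : ∃ i, A i ≠ 0 := by
    by_contra! h
    obtain ⟨n, hn1, hn⟩ := hA
    have hpos := hn 1 PosSemidef.one one_ne_zero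
    obtain ⟨m, rfl⟩ : ∃ m, n = m + 1 := ⟨n - 1, by omega⟩
    rw [Function.iterate_succ_apply'] at hpos
    simp only [transferMap, h, zero_mul, Finset.sum_const_zero] at hpos
    exact not_isUnit_zero hpos.isUnit
  obtain ⟨i, hi⟩ := hA'
  have hmul : ∀ M M', M * A i * M' ∈ longWordSpan A 1 := by
    intro M M'
    have hM : ∀ X, X ∈ longWordSpan A 0 := fun X => hA.longWordSpan_zero ▸ trivial
    have hi1 : A i ∈ longWordSpan A 1 := by
      simpa using wordProd_mem_longWordSpan (A := A) (K := 1) (w := [i]) le_rfl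
    exact longWordSpan_mul_le 1 0 (Submodule.mul_mem_mul
      (longWordSpan_mul_le 0 1 (Submodule.mul_mem_mul (hM M) hi1)) (hM M'))
  obtain ⟨p, q, hpq⟩ : ∃ p q, A i p q ≠ 0 := by
    by_contra! h
    exact hi (Matrix.ext h)
  refine eq_top_iff.mpr fun M _ => ?_
  rw [matrix_eq_sum_single M]
  refine Submodule.sum_mem _ fun r _ => Submodule.sum_mem _ fun s _ => ?_
  have := hmul (single r p (M r s * (A i p q)⁻¹)) (single q s 1)
  rwa [single_mul_mul_single, mul_one, mul_assoc, inv_mul_cancel₀ hpq, mul_one] at this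

/-- The products of a normal tensor along arbitrarily long words span the full matrix algebra. -/
theorem IsPrimitive.longWordSpan_eq_top (hA : IsPrimitive A) [NeZero D] (K : ℕ) :
    longWordSpan A K = ⊤ := by
  induction K with
  | zero => exact hA.longWordSpan_zero
  | succ K ih =>
    refine eq_top_iff.mpr fun M _ => ?_
    have h := longWordSpan_mul_le (A := A) K 1
      (Submodule.mul_mem_mul (m := M) (n := 1) (ih ▸ trivial) (hA.longWordSpan_one ▸ trivial))
    rwa [mul_one] at h

theorem IsPrimitive.exists_wordProd_ne_zero (hA : IsPrimitive A) [NeZero D] (K : ℕ) :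
    ∃ w : List (Fin d), K ≤ w.length ∧ wordProd A w ≠ 0 := by
  by_contra! h
  have hbot : longWordSpan A K = ⊥ := by
    rw [longWordSpan, Submodule.span_eq_bot]
    rintro _ ⟨w, hw, rfl⟩
    exact h w hw
  exact bot_ne_top (hbot.symm.trans (hA.longWordSpan_eq_top K))

/-- A matrix-valued function on long words that intertwines the left and right multiplication by
the products of a normal tensor is proportional to these products. -/
theorem IsPrimitive.exists_eq_smul_wordProd (hA : IsPrimitive A) [NeZero D] {K : ℕ}
    {X : List (Fin d) → Matrix (Fin D) (Fin D) ℂ}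
    (hl : ∀ u w, K ≤ w.length → X (u ++ w) = wordProd A u * X w)
    (hr : ∀ w u, K ≤ w.length → X (w ++ u) = X w * wordProd A u) :
    ∃ c : ℂ, ∀ w, K ≤ w.length → X w = c • wordProd A w := by
  have key : ∀ M ∈ longWordSpan A K, ∃ Z, ∀ w, K ≤ w.length →
      Z * wordProd A w = M * X w := by
    intro M hM
    induction hM using Submodule.span_induction with
    | mem _ h =>
      obtain ⟨u, hu, rfl⟩ := h
      exact ⟨X u, fun w hw => by rw [← hl u w hw, ← hr u w hu]⟩
    | zero => exact ⟨0, by simp⟩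
    | add M M' _ _ h h' =>
      obtain ⟨Z, hZ⟩ := h
      obtain ⟨Z', hZ'⟩ := h'
      exact ⟨Z + Z', fun w hw => by rw [add_mul, add_mul, hZ w hw, hZ' w hw]⟩
    | smul c M _ h =>
      obtain ⟨Z, hZ⟩ := h
      exact ⟨c • Z, fun w hw => by rw [smul_mul, smul_mul, hZ w hw]⟩
  obtain ⟨Z, hZ⟩ := key 1 (hA.longWordSpan_eq_top K ▸ trivial)
  simp only [one_mul] at hZ
  have hcomm : ∀ M ∈ longWordSpan A K, Commute M Z := by
    have hword : ∀ u, K ≤ u.length → ∀ M ∈ longWordSpan A K,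
        wordProd A u * Z * M = Z * wordProd A u * M := by
      intro u hu M hM
      induction hM using Submodule.span_induction with
      | mem _ h =>
        obtain ⟨w, hw, rfl⟩ := h
        rw [mul_assoc, hZ w hw, hZ u hu, ← hl u w hw, ← hr u w hu]
      | zero => simp
      | add M M' _ _ h h' => rw [mul_add, mul_add, h, h']
      | smul c M _ h => rw [Matrix.mul_smul, Matrix.mul_smul, h]
    intro M hM
    induction hM using Submodule.span_induction with
    | mem _ h =>
      obtain ⟨u, hu, rfl⟩ := h
      simpa [Commute, SemiconjBy] using hword u hu 1 (hA.longWordSpan_eq_top K ▸ trivial)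
    | zero => exact Commute.zero_left _
    | add M M' _ _ h h' => exact h.add_left h'
    | smul c M _ h => exact h.smul_left c
  obtain ⟨c, rfl⟩ := mem_range_scalar_iff_commute_single'.mpr fun i j =>
    hcomm (single i j 1) (hA.longWordSpan_eq_top K ▸ trivial)
  refine ⟨c, fun w hw => ?_⟩
  rw [← hZ w hw, scalar_apply, ← smul_eq_diagonal_mul]

end Span

section Reduction

variable {m p q α R : Type*} [Fintype p] [Fintype q] [DecidableEq q] [Ring R]
  {A : α → Matrix p p R} {B : α → Matrix q q R} {V : Matrix p q R} {W : Matrix q p R} {K : ℕ}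

/-- If `M * B^w * W` vanishes for all words, then `B` may be replaced by its nilpotent part
to the right of `M`. -/
theorem mul_wordProd_eq_mul_wordProd_sub {M : Matrix m q R}
    (hM : ∀ w, M * wordProd B w * W = 0) (w : List α) :
    M * wordProd B w = M * wordProd (fun j => B j - W * A j * V) w := by
  induction w using List.reverseRecOn with
  | nil => simp
  | append_singleton w i ih =>
    rw [wordProd_append, wordProd_append, ← Matrix.mul_assoc, ← Matrix.mul_assoc, ← ih,
      wordProd_singleton, wordProd_singleton, Matrix.mul_sub, Matrix.mul_assoc W,
      ← Matrix.mul_assoc _ W, hM, Matrix.zero_mul, sub_zero]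

/-- If `V * B^w * M` vanishes for all words, then `B` may be replaced by its nilpotent part
to the left of `M`. -/
theorem wordProd_mul_eq_wordProd_sub_mul {M : Matrix q m R}
    (hM : ∀ w, V * (wordProd B w * M) = 0) (w : List α) :
    wordProd B w * M = wordProd (fun j => B j - W * A j * V) w * M := by
  induction w with
  | nil => simp
  | cons i w ih =>
    rw [wordProd_cons, wordProd_cons, Matrix.mul_assoc, Matrix.mul_assoc, ← ih,
      Matrix.sub_mul, Matrix.mul_assoc (W * A i), hM, Matrix.mul_zero, sub_zero]

variable [DecidableEq p]

theorem mul_wordProd_append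
    (hred : ∀ w, V * wordProd B w * W = wordProd A w)
    (hnil : ∀ w, w ≠ [] → K ≤ w.length → wordProd (fun j => B j - W * A j * V) w = 0)
    (u : List α) {w : List α} (hw : K ≤ w.length) :
    V * wordProd B (u ++ w) = wordProd A u * (V * wordProd B w) := by
  have hVW : V * W = 1 := by simpa using hred []
  have step : ∀ i w, K ≤ w.length →
      V * wordProd B (i :: w) = A i * (V * wordProd B w) := by
    intro i w hw
    have hM : V * (B i - W * A i * V) = V * B i - A i * V := by
      rw [Matrix.mul_sub, Matrix.mul_assoc W, ← Matrix.mul_assoc, hVW, Matrix.one_mul]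
    have h := mul_wordProd_eq_mul_wordProd_sub (A := A) (V := V) (W := W) (B := B)
      (M := V * (B i - W * A i * V)) (fun w => by
        have := hred (i :: w)
        rw [wordProd_cons, wordProd_cons] at this
        rw [hM, Matrix.sub_mul, Matrix.sub_mul, Matrix.mul_assoc (A i), Matrix.mul_assoc (A i),
          hred, ← this, Matrix.mul_assoc V (B i), sub_self]) w
    have h0 := hnil (i :: w) (by simp) (by simp; omega)
    rw [wordProd_cons] at h0
    rw [Matrix.mul_assoc V _ (wordProd (fun j => B j - W * A j * V) w), h0, Matrix.mul_zero, hM,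
      Matrix.sub_mul, sub_eq_zero] at h
    rw [wordProd_cons, ← Matrix.mul_assoc, h, Matrix.mul_assoc]
  induction u with
  | nil => simp
  | cons i u ih =>
    rw [List.cons_append, step i _ (by simp; omega), ih, wordProd_cons, Matrix.mul_assoc]

theorem wordProd_append_mul
    (hred : ∀ w, V * wordProd B w * W = wordProd A w)
    (hnil : ∀ w, w ≠ [] → K ≤ w.length → wordProd (fun j => B j - W * A j * V) w = 0)
    {w : List α} (hw : K ≤ w.length) (u : List α) :
    wordProd B (w ++ u) * W = wordProd B w * W * wordProd A u := by
  have hVW : V * W = 1 := by simpa using hred []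
  have step : ∀ w i, K ≤ w.length →
      wordProd B (w ++ [i]) * W = wordProd B w * W * A i := by
    intro w i hw
    have hM : (B i - W * A i * V) * W = B i * W - W * A i := by
      rw [Matrix.sub_mul, Matrix.mul_assoc (W * A i), hVW, Matrix.mul_one]
    have h := wordProd_mul_eq_wordProd_sub_mul (A := A) (V := V) (W := W) (B := B)
      (M := (B i - W * A i * V) * W) (fun w => by
        have := hred (w ++ [i])
        rw [wordProd_append, wordProd_append, wordProd_singleton, wordProd_singleton] at this
        rw [← hred w] at this
        simp only [Matrix.mul_assoc] at this
        rw [hM, Matrix.mul_sub, Matrix.mul_sub, this, sub_self]) w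
    have h0 := hnil (w ++ [i]) (by simp) (by simp; omega)
    rw [wordProd_append, wordProd_singleton] at h0
    rw [← Matrix.mul_assoc (wordProd (fun j => B j - W * A j * V) w), h0, Matrix.zero_mul, hM,
      Matrix.mul_sub, sub_eq_zero] at h
    rw [wordProd_append, wordProd_singleton, Matrix.mul_assoc, h, Matrix.mul_assoc]
  induction u using List.reverseRecOn with
  | nil => simp
  | append_singleton u i ih =>
    rw [← List.append_assoc, step _ i (by simp; omega), ih, wordProd_append, wordProd_singleton]
    simp only [Matrix.mul_assoc]

end Reduction

section Compare

variable {p q α k : Type*} [Fintype p] [DecidableEq p] [Fintype q] [DecidableEq q] [Field k]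
  {A : α → Matrix p p k} {B : α → Matrix q q k} {V V' : Matrix p q k} {W W' : Matrix q p k}
  {K : ℕ} {c : k}

theorem mul_wordProd_eq_smul
    (hred : ∀ w, V' * wordProd B w * W' = wordProd A w)
    (hnil : ∀ w, w ≠ [] → K ≤ w.length → wordProd (fun j => B j - W' * A j * V') w = 0)
    (hc : ∀ w, K ≤ w.length → V * wordProd B w * W' = c • wordProd A w)
    {w : List α} (hw : 2 * K < w.length) :
    V * wordProd B w = c • (V' * wordProd B w) := by
  obtain ⟨u, x, rfl, hu⟩ : ∃ u x, w = u ++ x ∧ u.length = K :=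
    ⟨w.take K, w.drop K, (List.take_append_drop K w).symm, by simp; omega⟩
  rw [List.length_append] at hw
  have h := mul_wordProd_eq_mul_wordProd_sub (A := A) (V := V') (W := W') (B := B)
    (M := (V - c • V') * wordProd B u) (fun y => by
      rw [Matrix.mul_assoc _ (wordProd B u), ← wordProd_append, Matrix.sub_mul, Matrix.sub_mul,
        hc _ (by simp; omega), smul_mul, smul_mul, hred, sub_self]) x
  rw [hnil x (by rintro rfl; simp at hw; omega) (by omega), Matrix.mul_zero, Matrix.mul_assoc,
    ← wordProd_append, Matrix.sub_mul, sub_eq_zero, smul_mul] at h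
  exact h

theorem wordProd_mul_eq_smul
    (hred : ∀ w, V * wordProd B w * W = wordProd A w)
    (hnil : ∀ w, w ≠ [] → K ≤ w.length → wordProd (fun j => B j - W * A j * V) w = 0)
    (hc : ∀ w, K ≤ w.length → V * wordProd B w * W' = c • wordProd A w)
    {w : List α} (hw : 2 * K < w.length) :
    wordProd B w * W' = c • (wordProd B w * W) := by
  obtain ⟨x, u, rfl, hu⟩ : ∃ x u, w = x ++ u ∧ u.length = K :=
    ⟨w.take (w.length - K), w.drop (w.length - K), (List.take_append_drop _ w).symm,
      by simp; omega⟩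
  rw [List.length_append] at hw
  have h := wordProd_mul_eq_wordProd_sub_mul (A := A) (V := V) (W := W) (B := B)
    (M := wordProd B u * (W' - c • W)) (fun y => by
      rw [← Matrix.mul_assoc (wordProd B y), ← wordProd_append, ← Matrix.mul_assoc,
        Matrix.mul_sub, hc _ (by simp; omega), Matrix.mul_smul, hred, sub_self]) x
  rw [hnil x (by rintro rfl; simp at hw; omega) (by omega), Matrix.zero_mul, ← Matrix.mul_assoc,
    ← wordProd_append, Matrix.mul_sub, sub_eq_zero, Matrix.mul_smul] at h
  exact h

end Compare

/-- **Any two reductions to a normal tensor are related by a scalar.**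
If `(V, W)` and `(Ṽ, W̃)` are two reductions from `B` to a normal tensor `A`, both with
nilpotency length at most `N₀`, then there is a nonzero `λ ∈ ℂ` such that for all
`n > 2N₀`, `V B^{i_1}⋯B^{i_n} = λ Ṽ B^{i_1}⋯B^{i_n}` and
`B^{i_1}⋯B^{i_n} W = λ⁻¹ B^{i_1}⋯B^{i_n} W̃`. -/
theorem reductions_related {DA DB d : ℕ}
    (A : Fin d → Matrix (Fin DA) (Fin DA) ℂ) (B : Fin d → Matrix (Fin DB) (Fin DB) ℂ)
    (hA : IsPrimitive A)
    (V : Matrix (Fin DA) (Fin DB) ℂ) (W : Matrix (Fin DB) (Fin DA) ℂ)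
    (V' : Matrix (Fin DA) (Fin DB) ℂ) (W' : Matrix (Fin DB) (Fin DA) ℂ)
    (hVW : V * W = 1) (hVW' : V' * W' = 1)
    (hred : ∀ n : ℕ, 1 ≤ n → ∀ i : Fin n → Fin d,
      V * mpsProd B i * W = mpsProd A i)
    (hred' : ∀ n : ℕ, 1 ≤ n → ∀ i : Fin n → Fin d,
      V' * mpsProd B i * W' = mpsProd A i)
    (N₀ : ℕ)
    (hnil : ∀ n : ℕ, 1 ≤ n → N₀ ≤ n → ∀ i : Fin n → Fin d,
      mpsProd (fun j => B j - W * A j * V) i = 0)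
    (hnil' : ∀ n : ℕ, 1 ≤ n → N₀ ≤ n → ∀ i : Fin n → Fin d,
      mpsProd (fun j => B j - W' * A j * V') i = 0) :
    ∃ lam : ℂ, lam ≠ 0 ∧ ∀ n : ℕ, 2 * N₀ < n → ∀ i : Fin n → Fin d,
      V * mpsProd B i = lam • (V' * mpsProd B i) ∧
      mpsProd B i * W = lam⁻¹ • (mpsProd B i * W') := by
  have hword : ∀ (V : Matrix (Fin DA) (Fin DB) ℂ) (W : Matrix (Fin DB) (Fin DA) ℂ),
      V * W = 1 →
      (∀ n : ℕ, 1 ≤ n → ∀ i : Fin n → Fin d, V * mpsProd B i * W = mpsProd A i) →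
      ∀ w, V * wordProd B w * W = wordProd A w := by
    intro V W hVW h w
    rcases w with _ | ⟨i, w⟩
    · simpa using hVW
    · simpa only [mpsProd_get] using h (i :: w).length (by simp) (i :: w).get
  have hnilWord : ∀ (N : Fin d → Matrix (Fin DB) (Fin DB) ℂ),
      (∀ n : ℕ, 1 ≤ n → N₀ ≤ n → ∀ i : Fin n → Fin d, mpsProd N i = 0) →
      ∀ w, w ≠ [] → N₀ ≤ w.length → wordProd N w = 0 := by
    intro N h w hne hw
    simpa only [mpsProd_get] using h w.length (List.length_pos_of_ne_nil hne) hw w.get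
  replace hred := hword V W hVW hred
  replace hred' := hword V' W' hVW' hred'
  replace hnil := hnilWord _ hnil
  replace hnil' := hnilWord _ hnil'
  rcases Nat.eq_zero_or_pos DA with rfl | hpos
  · exact ⟨1, one_ne_zero, fun n _ i => ⟨Subsingleton.elim _ _, Subsingleton.elim _ _⟩⟩
  have : NeZero DA := ⟨hpos.ne'⟩
  obtain ⟨c, hc⟩ := hA.exists_eq_smul_wordProd (K := N₀) (X := fun w => V * wordProd B w * W')
    (fun u w hw => by
      simp only [mul_wordProd_append hred hnil u hw, Matrix.mul_assoc])
    (fun w u hw => by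
      simp only [Matrix.mul_assoc V, wordProd_append_mul hred' hnil' hw u])
  have hleft : ∀ w : List (Fin d), 2 * N₀ < w.length →
      V * wordProd B w = c • (V' * wordProd B w) :=
    fun w hw => mul_wordProd_eq_smul hred' hnil' hc hw
  have hright : ∀ w : List (Fin d), 2 * N₀ < w.length →
      wordProd B w * W' = c • (wordProd B w * W) :=
    fun w hw => wordProd_mul_eq_smul hred hnil hc hw
  have hc0 : c ≠ 0 := by
    rintro rfl
    obtain ⟨w, hw, hne⟩ := hA.exists_wordProd_ne_zero (2 * N₀ + 1)
    exact hne (by rw [← hred w, hleft w hw, zero_smul, Matrix.zero_mul])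
  refine ⟨c, hc0, fun n hn i => ?_⟩
  rw [mpsProd_eq_wordProd]
  have hlen : 2 * N₀ < (List.ofFn i).length := by simpa using hn
  exact ⟨hleft _ hlen, by rw [hright _ hlen, inv_smul_smul₀ hc0]⟩
end
end
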